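/- For every integer i ≥ 1 and every real number t ≠ 0, the i-th derivative at t of the function f(t) = 1/(e^t - 1) equals ∑_{m=1}^{i+1} μ_{i,m}/(1 - e^{-t})^m, where μ_{i,m} = (-1)^{m+1} · (m-1)! · S(i+1, m). -/

import Mathlib

/-- The Stirling numbers of the second kind, via the explicit formula. -/
def S (n m : ℕ) : ℚ :=
  (1 / (m.factorial : ℚ)) *
    ∑ ℓ ∈ Finset.range (m + 1), (-1 : ℚ) ^ (m - ℓ) * (m.choose ℓ : ℚ) * (ℓ : ℚ) ^ n

/-- The coefficients `μ_{i,m} = (-1)^{m+1} (m-1)! S(i+1, m)`. -/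
def mu (i m : ℕ) : ℚ := (-1 : ℚ) ^ (m + 1) * ((m - 1).factorial : ℚ) * S (i + 1) m

theorem S_zero_succ (m : ℕ) : S 0 (m + 1) = 0 := by
  unfold S
  have h := add_pow (1 : ℚ) (-1) (m + 1)
  simp only [add_neg_cancel, one_pow, one_mul] at h
  have h2 : ∑ l ∈ Finset.range (m + 1 + 1),
      (-1 : ℚ) ^ (m + 1 - l) * ((m + 1).choose l : ℚ) * (l : ℚ) ^ 0 = 0 := by
    simp only [pow_zero, mul_one]
    rw [← h]
    simp
  rw [h2, mul_zero]

theorem S_succ_succ (n m : ℕ) : S (n + 1) (m + 1) = (m + 1) * S n (m + 1) + S n m := by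
  have key : ∑ l ∈ Finset.range (m + 1 + 1),
      (-1 : ℚ) ^ (m + 1 - l) * ((m + 1).choose l : ℚ) * (l : ℚ) ^ (n + 1)
      = (m + 1) * ∑ l ∈ Finset.range (m + 1 + 1),
          (-1 : ℚ) ^ (m + 1 - l) * ((m + 1).choose l : ℚ) * (l : ℚ) ^ n
        + (m + 1) * ∑ l ∈ Finset.range (m + 1),
          (-1 : ℚ) ^ (m - l) * (m.choose l : ℚ) * (l : ℚ) ^ n := by
    rw [Finset.sum_range_succ _ (m + 1), Finset.sum_range_succ _ (m + 1), mul_add,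
      Finset.mul_sum, Finset.mul_sum, add_right_comm, ← Finset.sum_add_distrib]
    congr 1
    · refine Finset.sum_congr rfl fun l hl => ?_
      have hl' : l ≤ m := by simpa [Nat.lt_succ_iff] using hl
      have hc := Nat.choose_mul_succ_eq m l
      obtain ⟨d, rfl⟩ := Nat.exists_eq_add_of_le hl'
      have e1 : l + d + 1 - l = d + 1 := by omega
      have e2 : l + d - l = d := by omega
      rw [e1] at hc ⊢
      rw [e2]
      have hc' : ((l + d).choose l : ℚ) * (l + d + 1) = ((l + d + 1).choose l : ℚ) * (d + 1) := by
        exact_mod_cast hc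
      push_cast
      linear_combination (-(-1 : ℚ) ^ d * (l : ℚ) ^ n) * hc'
    · push_cast
      ring
  unfold S
  rw [key, Nat.factorial_succ]
  have h1 : (m.factorial : ℚ) ≠ 0 := by positivity
  have h2 : (m + 1 : ℚ) ≠ 0 := by positivity
  push_cast
  field_simp

theorem S_zero_right (n : ℕ) : S (n + 1) 0 = 0 := by
  simp [S]

theorem S_eq_zero_of_lt (n : ℕ) : ∀ m, n < m → S n m = 0 := by
  induction n with
  | zero =>
    rintro (_ | m) h
    · omega
    · exact S_zero_succ m
  | succ n ih =>
    rintro (_ | m) h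
    · omega
    · rw [S_succ_succ, ih _ (by omega), ih _ (by omega)]
      simp

theorem mu_succ (i m : ℕ) : mu (i + 1) (m + 2) = (m + 2) * mu i (m + 2) - (m + 1) * mu i (m + 1) := by
  unfold mu
  have e1 : m + 2 - 1 = m + 1 := by omega
  have e2 : m + 1 - 1 = m := by omega
  rw [e1, e2, S_succ_succ (i + 1) (m + 1), Nat.factorial_succ]
  push_cast
  ring

theorem mu_succ_one (i : ℕ) : mu (i + 1) 1 = mu i 1 := by
  unfold mu
  rw [S_succ_succ (i + 1) 0, S_zero_right]
  simp

theorem mu_top (i : ℕ) : mu i (i + 2) = 0 := by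
  unfold mu
  rw [S_eq_zero_of_lt _ _ (by omega), mul_zero]

theorem mu_zero_one : mu 0 1 = 1 := by
  simp [mu, S, Finset.sum_range_succ]

theorem sum_step (i : ℕ) (y : ℝ) :
    ∑ m ∈ Finset.range (i + 1), (mu i (m + 1) : ℝ) * ((m + 1) * (y ^ (m + 1) - y ^ (m + 2)))
      = ∑ m ∈ Finset.range (i + 2), (mu (i + 1) (m + 1) : ℝ) * y ^ (m + 1) := by
  have h : ∀ m, (mu (i + 1) (m + 1 + 1) : ℝ)
      = (m + 2) * mu i (m + 2) - (m + 1) * mu i (m + 1) := by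
    intro m
    rw [mu_succ]
    push_cast
    ring
  have h3 : ∑ m ∈ Finset.range (i + 1), (mu i (m + 1) : ℝ) * ((m + 1) * y ^ (m + 1))
      = ∑ m ∈ Finset.range (i + 1), (mu i (m + 2) : ℝ) * ((m + 2) * y ^ (m + 2))
        + (mu i 1 : ℝ) * y := by
    have a := Finset.sum_range_succ (fun m : ℕ => (mu i (m + 1) : ℝ) * ((m + 1) * y ^ (m + 1))) (i + 1)
    have b := Finset.sum_range_succ' (fun m : ℕ => (mu i (m + 1) : ℝ) * ((m + 1) * y ^ (m + 1))) (i + 1)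
    rw [a] at b
    simp only [mu_top, Rat.cast_zero, zero_mul, add_zero] at b
    rw [b]
    congr 1
    · refine Finset.sum_congr rfl fun m _ => ?_
      push_cast
      ring
    · simp
  rw [Finset.sum_range_succ' _ (i + 1)]
  simp only [h, zero_add, mu_succ_one, pow_one]
  simp only [mul_sub, Finset.sum_sub_distrib]
  rw [h3, add_sub_right_comm, ← Finset.sum_sub_distrib]
  congr 1
  refine Finset.sum_congr rfl fun m _ => ?_
  ring

theorem hasDerivAt_y (t : ℝ) (ht : t ≠ 0) :
    HasDerivAt (fun s : ℝ => (1 - Real.exp (-s))⁻¹)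
      ((1 - Real.exp (-t))⁻¹ - ((1 - Real.exp (-t))⁻¹) ^ 2) t := by
  have hne : 1 - Real.exp (-t) ≠ 0 := by
    intro h
    apply ht
    have : Real.exp (-t) = 1 := by linarith
    simpa using this
  have h1 : HasDerivAt (fun s : ℝ => 1 - Real.exp (-s)) (Real.exp (-t)) t := by
    simpa using ((hasDerivAt_neg t).exp).const_sub 1
  have h2 := h1.fun_inv hne
  have e : (1 - Real.exp (-t))⁻¹ - ((1 - Real.exp (-t))⁻¹) ^ 2
      = -Real.exp (-t) / (1 - Real.exp (-t)) ^ 2 := by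
    field_simp
    ring
  rw [e]
  exact h2

theorem iter_aux (i : ℕ) : ∀ t : ℝ, t ≠ 0 →
    iteratedDeriv i (fun s : ℝ => 1 / (Real.exp s - 1)) t =
      ∑ m ∈ Finset.range (i + 1), (mu i (m + 1) : ℝ) * ((1 - Real.exp (-t))⁻¹) ^ (m + 1)
        - (if i = 0 then 1 else 0) := by
  induction i with
  | zero =>
    intro t ht
    have hne : Real.exp t - 1 ≠ 0 := by
      intro h
      apply ht
      have : Real.exp t = 1 := by linarith
      simpa using this
    have hpos := Real.exp_pos t
    have h : 1 - Real.exp (-t) = (Real.exp t - 1) / Real.exp t := by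
      rw [Real.exp_neg]
      field_simp
    simp only [iteratedDeriv_zero, zero_add, Finset.sum_range_one, mu_zero_one, h]
    simp
    field_simp
    ring
  | succ i ih =>
    intro t ht
    rw [iteratedDeriv_succ]
    have hev : iteratedDeriv i (fun s : ℝ => 1 / (Real.exp s - 1)) =ᶠ[nhds t]
        fun t => ∑ m ∈ Finset.range (i + 1),
          (mu i (m + 1) : ℝ) * ((1 - Real.exp (-t))⁻¹) ^ (m + 1) - (if i = 0 then 1 else 0) := by
      filter_upwards [isOpen_ne.mem_nhds ht] with s hs using ih s hs
    rw [hev.deriv_eq, if_neg (Nat.succ_ne_zero i), sub_zero, ← sum_step]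
    apply HasDerivAt.deriv
    apply HasDerivAt.sub_const
    apply HasDerivAt.fun_sum
    intro m _
    apply HasDerivAt.const_mul
    convert (hasDerivAt_y t ht).fun_pow (m + 1) using 1
    push_cast
    ring

theorem iteratedDeriv_one_div_exp_sub_one_mu (i : ℕ) (hi : 1 ≤ i) (t : ℝ) (ht : t ≠ 0) :
    iteratedDeriv i (fun s : ℝ => 1 / (Real.exp s - 1)) t =
      ∑ m ∈ Finset.Icc 1 (i + 1), (mu i m : ℝ) / (1 - Real.exp (-t)) ^ m := by
  rw [iter_aux i t ht, if_neg (by omega), sub_zero, Finset.range_eq_Ico,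
    Finset.sum_Ico_add' (fun m => (mu i m : ℝ) * ((1 - Real.exp (-t))⁻¹) ^ m) 0 (i + 1) 1]
  refine Finset.sum_congr ?_ fun m _ => ?_
  · ext x
    simp only [Finset.mem_Ico, Finset.mem_Icc]
    omega
  · rw [inv_pow, div_eq_mul_inv]
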